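/- For a relativistic star with nonincreasing average density and surface pressure p(R) ≥ 0, the central pressure satisfies p_c ≥ p(r) - (3/(16π))·(m(r)/r³)·ln(1 - 2m(r)/r) for all r, and in particular p_c ≥ -(3/(16π))·(M/R³)·ln(1 - 2M/R). -/

import Mathlib

open Real Set

open MeasureTheory Filter Topology

lemma antitone_of_ae_deriv_nonpos {f f' : ℝ → ℝ} {a b : ℝ} (hab : a ≤ b)
    (hc : ContinuousOn f (Icc a b)) (hd : ∀ x ∈ Ioo a b, HasDerivAt f (f' x) x)
    (hae : ∀ᵐ x, x ∈ Ioo a b → f' x ≤ 0) : f b ≤ f a := by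
  classical
  set φ : ℝ → ℝ := fun x => if x ∈ Ioo a b then max (f' x) 0 else 0 with hφ
  have h0 : φ =ᵐ[volume] 0 := by
    filter_upwards [hae] with x hx
    by_cases h : x ∈ Ioo a b
    · simp only [hφ, h, if_true, Pi.zero_apply]
      exact max_eq_right (hx h)
    · simp only [hφ, h, if_false, Pi.zero_apply]
  have hint : Integrable φ volume := (integrable_zero ℝ ℝ volume).congr h0.symm
  have := intervalIntegral.sub_le_integral_of_hasDeriv_right_of_le hab hc
    (fun x hx => (hd x hx).hasDerivWithinAt) hint.integrableOn
    (φ := φ) (fun x hx => by simp only [hφ, hx, if_true]; exact le_max_left _ _)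
  have h2 : ∫ y in a..b, φ y = 0 := by
    rw [intervalIntegral.integral_congr_ae (g := fun _ => (0:ℝ))]
    · simp
    · filter_upwards [h0] with x hx _
      simpa using hx
  linarith

lemma ae_key (R : ℝ) (m ρ : ℝ → ℝ)
    (hm : ∀ r ∈ Icc (0:ℝ) R, m r = ∫ s in (0:ℝ)..r, 4 * π * ρ s * s ^ 2)
    (hmnn : ∀ r ∈ Icc (0:ℝ) R, 0 ≤ m r)
    (hmdiff : DifferentiableOn ℝ m (Icc 0 R)) :
    ∀ᵐ x, x ∈ Ioo 0 R → deriv m x * m x = 4 * π * ρ x * x ^ 2 * m x := by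
  have hq : ∀ᵐ x, ∀ q : ℚ, IntervalIntegrable (fun s => 4 * π * ρ s * s ^ 2) volume 0 (q:ℝ) →
      x ∈ uIcc (0:ℝ) q → ∀ c ∈ uIcc (0:ℝ) q,
      HasDerivAt (fun x => ∫ (t : ℝ) in c..x, 4 * π * ρ t * t ^ 2) (4 * π * ρ x * x ^ 2) x := by
    rw [ae_all_iff]
    intro q
    by_cases h : IntervalIntegrable (fun s => 4 * π * ρ s * s ^ 2) volume 0 (q:ℝ)
    · filter_upwards [h.ae_hasDerivAt_integral] with x hx _
      exact hx
    · exact Eventually.of_forall fun x h' => absurd h' h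
  filter_upwards [hq] with x hx hxR
  by_cases hmx : m x = 0
  · simp [hmx]
  have hnhds : Icc 0 R ∈ 𝓝 x := Icc_mem_nhds hxR.1 hxR.2
  have hcont : ContinuousAt m x := (hmdiff.differentiableAt hnhds).continuousAt
  have hev : ∀ᶠ y in 𝓝 x, m y ≠ 0 ∧ y ∈ Icc 0 R := (hcont.eventually_ne hmx).and hnhds
  obtain ⟨ε, hε, hball⟩ := Metric.eventually_nhds_iff.1 hev
  obtain ⟨q, hq1, hq2⟩ := exists_rat_btwn (show x < x + ε by linarith)
  obtain ⟨hq3, hq4⟩ := hball (y := (q:ℝ)) (by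
    rw [Real.dist_eq, abs_of_pos] <;> linarith)
  have hii : IntervalIntegrable (fun s => 4 * π * ρ s * s ^ 2) volume 0 (q:ℝ) := by
    by_contra hn
    exact hq3 (by rw [hm _ hq4]; exact intervalIntegral.integral_undef hn)
  have hd := hx q hii (by rw [uIcc_of_le hq4.1]; exact ⟨hxR.1.le, hq1.le⟩) 0 left_mem_uIcc
  have heq : m =ᶠ[𝓝 x] (fun x => ∫ (t : ℝ) in (0:ℝ)..x, 4 * π * ρ t * t ^ 2) := by
    filter_upwards [hnhds] with y hy using hm y hy
  rw [(hd.congr_of_eventuallyEq heq).deriv]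

/-- Corollary of the relativistic pressure monotonicity: the central pressure
dominates `p(r) - (3/(16π)) (m(r)/r³) ln(1-2m(r)/r)`, and in particular
`p_c ≥ -(3/(16π)) (M/R³) ln(1-2M/R)`. -/
theorem tov_central_pressure_bound
    (R : ℝ) (hR : 0 < R) (m ρ p : ℝ → ℝ)
    (hρ : ∀ s ∈ Icc (0:ℝ) R, 0 ≤ ρ s)
    (hppos : ∀ r ∈ Icc (0:ℝ) R, 0 ≤ p r)
    (hm : ∀ r ∈ Icc (0:ℝ) R, m r = ∫ s in (0:ℝ)..r, 4 * π * ρ s * s ^ 2)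
    (hmdiff : DifferentiableOn ℝ m (Icc 0 R))
    (hcompact : ∀ r ∈ Ioc (0:ℝ) R, 2 * m r / r < 1)
    (havg : AntitoneOn (fun r => 3 * m r / (4 * π * r ^ 3)) (Ioc 0 R))
    (hpdiff : ∀ r ∈ Ioc (0:ℝ) R, DifferentiableAt ℝ p r)
    (htov : ∀ r ∈ Ioc (0:ℝ) R,
      deriv p r ≤ -(ρ r * m r) / (r ^ 2 * (1 - 2 * m r / r)))
    (hpc : ContinuousWithinAt p (Icc 0 R) 0)
    (hpR : 0 ≤ p R) :
    (∀ r ∈ Ioc (0:ℝ) R,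
        p 0 ≥ p r - (3 / (16 * π)) * (m r / r ^ 3) * Real.log (1 - 2 * m r / r)) ∧
      p 0 ≥ -(3 / (16 * π)) * (m R / R ^ 3) * Real.log (1 - 2 * m R / R) := by

  have hmnn : ∀ r ∈ Icc (0:ℝ) R, 0 ≤ m r := by
    intro r hr
    rw [hm r hr]
    refine intervalIntegral.integral_nonneg hr.1 fun s hs => ?_
    have := hρ s ⟨hs.1, hs.2.trans hr.2⟩
    positivity
  have hm0 : m 0 = 0 := by rw [hm 0 ⟨le_rfl, hR.le⟩]; simp
  have hkey := ae_key R m ρ hm hmnn hmdiff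
  have hmd : ∀ x ∈ Ioo 0 R, HasDerivAt m (deriv m x) x := fun x hx =>
    (hmdiff.differentiableAt (Icc_mem_nhds hx.1 hx.2)).hasDerivAt
  have hpd : ∀ x ∈ Ioc 0 R, HasDerivAt p (deriv p x) x := fun x hx => (hpdiff x hx).hasDerivAt
  have hpcont : ContinuousOn p (Icc 0 R) := by
    intro x hx
    rcases hx.1.eq_or_lt with h | h
    · rw [← h]; exact hpc
    · exact (hpdiff x ⟨h, hx.2⟩).continuousAt.continuousWithinAt
  have hmcont : ContinuousOn m (Icc 0 R) := hmdiff.continuousOn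
  have hπ := Real.pi_pos
  -- the derivative of the average density is nonpositive
  have hda : ∀ x ∈ Ioo 0 R, x * deriv m x ≤ 3 * m x := by
    intro x hx
    have hx0 : 0 < x := hx.1
    have hn : Ioc 0 R ∈ 𝓝 x := Ioc_mem_nhds hx.1 hx.2
    have h1 := havg.derivWithin_nonpos (x := x)
    rw [derivWithin_of_mem_nhds hn] at h1
    have h2 : HasDerivAt (fun r => 3 * m r / (4 * π * r ^ 3))
        ((3 * deriv m x * (4 * π * x ^ 3) - 3 * m x * (4 * π * (3 * x ^ 2))) /
          (4 * π * x ^ 3) ^ 2) x := by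
      have h3 : HasDerivAt (fun r : ℝ => 4 * π * r ^ 3) (4 * π * (3 * x ^ 2)) x := by
        simpa using (hasDerivAt_pow 3 x).const_mul (4 * π)
      exact ((hmd x hx).const_mul 3).div h3 (by positivity)
    rw [h2.deriv] at h1
    have h4 : (3 * deriv m x * (4 * π * x ^ 3) - 3 * m x * (4 * π * (3 * x ^ 2))) /
          (4 * π * x ^ 3) ^ 2 = (3 / (4 * π * x ^ 4)) * (x * deriv m x - 3 * m x) := by
      field_simp
    rw [h4] at h1
    have h5 : 0 < 3 / (4 * π * x ^ 4) := by positivity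
    by_contra hcon
    push Not at hcon
    have := mul_pos h5 (sub_pos.2 hcon)
    linarith
  have hD : ∀ x ∈ Ioc 0 R, 0 < 1 - 2 * m x / x := fun x hx => by linarith [hcompact x hx]
  have hu : ∀ x ∈ Ioc 0 R, 0 ≤ 2 * m x / x := fun x hx =>
    div_nonneg (mul_nonneg two_pos.le (hmnn x ⟨hx.1.le, hx.2⟩)) hx.1.le
  -- the TOV inequality in terms of the derivative of m
  have hp' : ∀ᵐ x, x ∈ Ioo 0 R → 0 ≤ deriv m x * m x ∧
      deriv p x ≤ -(deriv m x * m x / (4 * π * x ^ 4) / (1 - 2 * m x / x)) := by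
    filter_upwards [hkey] with x hk hx
    have hx' : x ∈ Ioc 0 R := ⟨hx.1, hx.2.le⟩
    have hx0 : 0 < x := hx.1
    have h1 := hρ x ⟨hx.1.le, hx.2.le⟩
    have h2 := hmnn x ⟨hx.1.le, hx.2.le⟩
    refine ⟨by rw [hk hx]; positivity, (htov x hx').trans (le_of_eq ?_)⟩
    rw [hk hx]
    have := (hD x hx').ne'
    generalize 1 - 2 * m x / x = D at this
    field_simp
  -- bound of the mass by the pressure drop
  have hmb : ∀ r ∈ Ioo 0 R, m r ^ 2 ≤ 8 * π * r ^ 4 * (p 0 - p r) := by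
    intro r hr
    have hr0 : 0 < r := hr.1
    have hsub : Icc 0 r ⊆ Icc 0 R := Icc_subset_Icc le_rfl hr.2.le
    have := antitone_of_ae_deriv_nonpos (f := fun s => m s ^ 2 + 8 * π * r ^ 4 * p s)
      (f' := fun s => 2 * m s * deriv m s + 8 * π * r ^ 4 * deriv p s) hr0.le
      (((hmcont.mono hsub).pow 2).add (continuousOn_const.mul (hpcont.mono hsub)))
      (fun x hx => by
        have hxR : x ∈ Ioo 0 R := ⟨hx.1, hx.2.trans hr.2⟩
        have h0 : HasDerivAt (fun s => m s ^ 2) (2 * m x * deriv m x) x := by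
          simpa using (hmd x hxR).fun_pow 2
        exact h0.add ((hpd x ⟨hxR.1, hxR.2.le⟩).const_mul (8 * π * r ^ 4)))
      (by
        filter_upwards [hp'] with x hk hx
        have hxR : x ∈ Ioo 0 R := ⟨hx.1, hx.2.trans hr.2⟩
        have hx' : x ∈ Ioc 0 R := ⟨hxR.1, hxR.2.le⟩
        have hx0 : 0 < x := hx.1
        obtain ⟨h1, h2⟩ := hk hxR
        have h3 : deriv m x * m x / (4 * π * x ^ 4) ≤
            deriv m x * m x / (4 * π * x ^ 4) / (1 - 2 * m x / x) :=
          le_div_self (by positivity) (hD x hx') (by linarith [hu x hx'])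
        have h4 : deriv m x * m x / (4 * π * r ^ 4) ≤ deriv m x * m x / (4 * π * x ^ 4) := by
          have := hx.2.le
          gcongr
        have h5 : deriv p x ≤ -(deriv m x * m x / (4 * π * r ^ 4)) := by linarith
        have h6 : 8 * π * r ^ 4 * deriv p x ≤
            8 * π * r ^ 4 * -(deriv m x * m x / (4 * π * r ^ 4)) := by gcongr
        have h7 : 8 * π * r ^ 4 * -(deriv m x * m x / (4 * π * r ^ 4)) =
            -(2 * m x * deriv m x) := by
          field_simp
          ring
        linarith)
    simp only [hm0] at this
    nlinarith [this]
  -- monotonicity of the main functional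
  have hF : ∀ ε r, 0 < ε → ε ≤ r → r ≤ R →
      p r - (3 / (16 * π)) * (m r / r ^ 3) * Real.log (1 - 2 * m r / r) ≤
      p ε - (3 / (16 * π)) * (m ε / ε ^ 3) * Real.log (1 - 2 * m ε / ε) := by
    intro ε r hε hεr hrR
    have hsub : Icc ε r ⊆ Icc 0 R := Icc_subset_Icc hε.le hrR
    have hne : ∀ x ∈ Icc ε r, x ≠ 0 := fun x hx => (hε.trans_le hx.1).ne'
    refine antitone_of_ae_deriv_nonpos
      (f := fun r => p r - (3 / (16 * π)) * (m r / r ^ 3) * Real.log (1 - 2 * m r / r))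
      (f' := fun x => deriv p x -
        ((3 / (16 * π)) * ((deriv m x * x ^ 3 - m x * (3 * x ^ 2)) / (x ^ 3) ^ 2) *
            Real.log (1 - 2 * m x / x) +
          (3 / (16 * π)) * (m x / x ^ 3) *
            ((-((2 * deriv m x * x - 2 * m x * 1) / x ^ 2)) / (1 - 2 * m x / x)))) hεr ?_ ?_ ?_
    · refine (hpcont.mono hsub).sub (ContinuousOn.mul (continuousOn_const.mul
        ((hmcont.mono hsub).div (continuousOn_id.pow 3) fun x hx => pow_ne_zero 3 (hne x hx))) ?_)
      refine ContinuousOn.log (continuousOn_const.sub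
        ((continuousOn_const.mul (hmcont.mono hsub)).div continuousOn_id hne)) ?_
      exact fun x hx => (hD x ⟨hε.trans_le hx.1, hx.2.trans hrR⟩).ne'
    · intro x hx
      have hx0 : 0 < x := hε.trans hx.1
      have hxR : x ∈ Ioo 0 R := ⟨hx0, hx.2.trans_le hrR⟩
      have hx' : x ∈ Ioc 0 R := ⟨hxR.1, hxR.2.le⟩
      have h3 : HasDerivAt (fun r : ℝ => r ^ 3) (3 * x ^ 2) x := by
        simpa using hasDerivAt_pow 3 x
      have h4 := (((hmd x hxR).div h3 (by positivity)).const_mul (3 / (16 * π)))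
      have h5 := ((((hmd x hxR).const_mul 2).div (hasDerivAt_id x) hx0.ne').const_sub 1).log
        (hD x hx').ne'
      exact (hpd x hx').sub (h4.mul h5)
    · filter_upwards [hp'] with x hk hx
      have hx0 : 0 < x := hε.trans hx.1
      have hxR : x ∈ Ioo 0 R := ⟨hx0, hx.2.trans_le hrR⟩
      have hx' : x ∈ Ioc 0 R := ⟨hxR.1, hxR.2.le⟩
      obtain ⟨-, h2⟩ := hk hxR
      have hDx := hD x hx'
      have hux := hu x hx'
      have hlog : Real.log (1 - 2 * m x / x) ≤ 0 := Real.log_nonpos hDx.le (by linarith)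
      have hmx := hmnn x ⟨hx0.le, hx'.2⟩
      have hd := hda x hxR
      generalize Real.log (1 - 2 * m x / x) = L at *
      generalize 1 - 2 * m x / x = D at *
      generalize deriv m x = m' at *
      generalize m x = y at *
      generalize deriv p x = p' at *
      have e1 : 0 ≤ (3 / (16 * π)) * ((m' * x ^ 3 - y * (3 * x ^ 2)) / (x ^ 3) ^ 2) * L := by
        have : (3 / (16 * π)) * ((m' * x ^ 3 - y * (3 * x ^ 2)) / (x ^ 3) ^ 2) * L =
          (3 / (16 * π * x ^ 4)) * ((3 * y - x * m') * (-L)) := by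
          field_simp
          ring
        rw [this]
        exact mul_nonneg (by positivity) (mul_nonneg (by linarith) (by linarith))
      have e2 : (3 / (16 * π)) * (y / x ^ 3) * ((-((2 * m' * x - 2 * y * 1) / x ^ 2)) / D) =
          -(m' * y / (4 * π * x ^ 4) / D) + y / (8 * π * x ^ 5 * D) * (3 * y - x * m') := by
        field_simp
        ring
      have e3 : 0 ≤ y / (8 * π * x ^ 5 * D) * (3 * y - x * m') :=
        mul_nonneg (by positivity) (by linarith)
      linarith
  have hmain : ∀ r ∈ Ioc (0:ℝ) R,
        p 0 ≥ p r - (3 / (16 * π)) * (m r / r ^ 3) * Real.log (1 - 2 * m r / r) := by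
    intro r hr
    have hlt : 𝓝[Ioo 0 r] (0:ℝ) ≤ 𝓝[Icc 0 R] (0:ℝ) :=
      nhdsWithin_mono _ fun x hx => ⟨hx.1.le, hx.2.le.trans hr.2⟩
    have hpt : Tendsto p (𝓝[Ioo 0 r] (0:ℝ)) (𝓝 (p 0)) := hpc.tendsto.mono_left hlt
    have hid : Tendsto (fun x : ℝ => x) (𝓝[Ioo 0 r] (0:ℝ)) (𝓝 0) :=
      tendsto_id.mono_left nhdsWithin_le_nhds
    have hxt : Tendsto (fun x => 8 * π * x ^ 2 * (p 0 - p x)) (𝓝[Ioo 0 r] (0:ℝ)) (𝓝 0) := by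
      simpa using ((hid.pow 2).const_mul (8 * π)).mul (hpt.const_sub (p 0))
    have hG : Tendsto (fun x => p x + 6 * (p 0 - p x)) (𝓝[Ioo 0 r] (0:ℝ)) (𝓝 (p 0)) := by
      simpa using hpt.add ((hpt.const_sub (p 0)).const_mul 6)
    haveI : (𝓝[Ioo 0 r] (0:ℝ)).NeBot := left_nhdsWithin_Ioo_neBot hr.1
    refine ge_of_tendsto hG ?_
    filter_upwards [hxt.eventually (gt_mem_nhds (show (0:ℝ) < 1 / 16 by norm_num)),
      self_mem_nhdsWithin] with x hx1 hx
    have hxR : x ∈ Ioo 0 R := ⟨hx.1, hx.2.trans_le hr.2⟩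
    have hx' : x ∈ Ioc 0 R := ⟨hxR.1, hxR.2.le⟩
    have hx0 : 0 < x := hx.1
    refine (hF x r hx.1 hx.2.le hr.2).trans ?_
    have hb := hmb x hxR
    have hmx := hmnn x ⟨hx0.le, hx'.2⟩
    have hDx := hD x hx'
    have hux := hu x hx'
    have hu2 : 2 * m x / x ≤ 1 / 2 := by
      have : (m x / x) ^ 2 ≤ (1 / 4) ^ 2 := by
        have h : (m x / x) ^ 2 ≤ 8 * π * x ^ 2 * (p 0 - p x) := by
          rw [div_pow, div_le_iff₀ (by positivity)]
          linarith
        linarith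
      have := abs_le_of_sq_le_sq this (by norm_num)
      rw [mul_div_assoc]
      linarith [le_abs_self (m x / x)]
    have hl : -Real.log (1 - 2 * m x / x) ≤ 2 * (2 * m x / x) := by
      have h1 := Real.one_sub_inv_le_log_of_pos hDx
      have h2 : (1 - 2 * m x / x)⁻¹ ≤ 1 + 2 * (2 * m x / x) := by
        rw [inv_le_iff_one_le_mul₀ hDx]
        nlinarith
      linarith
    have h3 : (3 / (16 * π)) * (m x / x ^ 3) * (-Real.log (1 - 2 * m x / x)) ≤
        (3 / (16 * π)) * (m x / x ^ 3) * (2 * (2 * m x / x)) := by gcongr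
    have h4 : (3 / (16 * π)) * (m x / x ^ 3) * (2 * (2 * m x / x)) =
        (3 / (4 * π * x ^ 4)) * m x ^ 2 := by
      field_simp
      ring
    have h5 : (3 / (4 * π * x ^ 4)) * m x ^ 2 ≤
        (3 / (4 * π * x ^ 4)) * (8 * π * x ^ 4 * (p 0 - p x)) := by gcongr
    have h6 : (3 / (4 * π * x ^ 4)) * (8 * π * x ^ 4 * (p 0 - p x)) = 6 * (p 0 - p x) := by
      field_simp
      ring
    linarith
  refine ⟨hmain, ?_⟩
  have := hmain R ⟨hR, le_rfl⟩
  linarith
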